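/- Let X and Y be topological spaces. For every ordinal α and every natural number n, the (ω^α · n)-th Cantor–Bendixson derivative of the product satisfies (X × Y)^(ω^α · n) = ⋃_{r + s = n} X^(ω^α · r) × Y^(ω^α · s), where the union is over pairs of natural numbers r, s ≥ 0 with r + s = n. -/

import Mathlib

/-- The transfinite Cantor–Bendixson derivatives of a subspace `s` of a topological
space, where the derived set at each step is computed in the subspace topology
(equivalently, `D^(α+1) = D^α ∩ derivedSet (D^α)`), with intersections at limits. -/
noncomputable def cbDeriv {T : Type*} [TopologicalSpace T] (s : Set T) (o : Ordinal) : Set T :=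
  Ordinal.limitRecOn o s (fun _ ih => ih ∩ derivedSet ih)
    (fun o _ ih => ⋂ (b : Set.Iio o), ih b.1 b.2)

open Set Topology

section NaturalSum

universe u

/-- The natural (Hessenberg) sum of two ordinals: the least ordinal exceeding all the natural sums
obtained by decreasing one of the summands. -/
noncomputable def natSum (a b : Ordinal.{u}) : Ordinal.{u} :=
  max (⨆ x : Iio a, Order.succ (natSum x.1 b)) (⨆ x : Iio b, Order.succ (natSum a x.1))
termination_by (a, b)
decreasing_by
  · exact Prod.Lex.left _ _ x.2
  · exact Prod.Lex.right _ x.2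

theorem lt_natSum_iff {a b c : Ordinal.{u}} :
    c < natSum a b ↔ (∃ a' < a, c ≤ natSum a' b) ∨ ∃ b' < b, c ≤ natSum a b' := by
  rw [natSum, lt_max_iff, Ordinal.lt_iSup_iff, Ordinal.lt_iSup_iff]
  simp

theorem natSum_le_iff {a b c : Ordinal.{u}} :
    natSum a b ≤ c ↔ (∀ a' < a, natSum a' b < c) ∧ ∀ b' < b, natSum a b' < c := by
  rw [← not_lt, lt_natSum_iff]
  simp

theorem natSum_strictMono_left (b : Ordinal.{u}) : StrictMono (natSum · b) :=
  fun _ _ h => lt_natSum_iff.2 (Or.inl ⟨_, h, le_rfl⟩)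

theorem natSum_strictMono_right (a : Ordinal.{u}) : StrictMono (natSum a) :=
  fun _ _ h => lt_natSum_iff.2 (Or.inr ⟨_, h, le_rfl⟩)

theorem add_le_natSum (a b : Ordinal.{u}) : a + b ≤ natSum a b := by
  induction b using WellFoundedLT.induction with
  | ind b ih =>
    refine le_of_forall_lt fun c hc => ?_
    rcases lt_or_ge c a with h | h
    · exact h.trans_le (natSum_strictMono_left b).le_apply
    · obtain ⟨d, rfl⟩ := exists_add_of_le h
      have hd : d < b := (add_lt_add_iff_left a).1 hc
      exact (ih d hd).trans_lt (natSum_strictMono_right a hd)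

theorem exists_eq_mul_nat_add_of_lt {c x ρ : Ordinal.{u}} {r : ℕ} (hρ : ρ < c)
    (hx : x < c * r + ρ) :
    ∃ (k : ℕ) (τ : Ordinal.{u}), τ < c ∧ x = c * k + τ ∧ (k < r ∨ k = r ∧ τ < ρ) := by
  have h : x < c * ((r + 1 : ℕ) : Ordinal) := by
    rw [Nat.cast_succ, mul_add_one]
    exact hx.trans ((add_lt_add_iff_left _).2 hρ)
  obtain ⟨q, hq, τ, hτ, rfl⟩ := Ordinal.lt_mul_iff.1 h
  obtain ⟨k, rfl⟩ := Ordinal.lt_omega0.1 (hq.trans (Ordinal.natCast_lt_omega0 _))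
  have hk : k < r + 1 := by exact_mod_cast hq
  refine ⟨k, τ, hτ, rfl, ?_⟩
  rcases (Nat.lt_succ_iff.1 hk).lt_or_eq with h | rfl
  · exact Or.inl h
  · exact Or.inr ⟨rfl, (add_lt_add_iff_left _).1 hx⟩

theorem mul_nat_add_lt_mul_nat_add {c x : Ordinal.{u}} (y : Ordinal.{u}) {m n : ℕ} (hx : x < c)
    (h : m < n) : c * m + x < c * n + y :=
  calc c * m + x < c * m + c := (add_lt_add_iff_left _).2 hx
    _ = c * ((m + 1 : ℕ) : Ordinal) := by rw [Nat.cast_succ, mul_add_one]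
    _ ≤ c * n := by gcongr; exact h
    _ ≤ c * n + y := le_self_add

theorem natSum_mul_nat_add_le {c : Ordinal.{u}} (hc : ∀ x < c, ∀ y < c, natSum x y < c) (r s : ℕ)
    {ρ σ : Ordinal.{u}} (hρ : ρ < c) (hσ : σ < c) :
    natSum (c * r + ρ) (c * s + σ) ≤ c * ((r + s : ℕ) : Ordinal) + natSum ρ σ := by
  generalize ha : c * r + ρ = a
  generalize hb : c * s + σ = b
  induction a using WellFoundedLT.induction generalizing b r s ρ σ with
  | ind a iha =>
    induction b using WellFoundedLT.induction generalizing r s ρ σ with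
    | ind b ihb =>
      subst ha hb
      refine natSum_le_iff.2 ⟨fun a' ha' => ?_, fun b' hb' => ?_⟩
      · obtain ⟨k, τ, hτ, rfl, hk⟩ := exists_eq_mul_nat_add_of_lt hρ ha'
        refine (iha _ ha' k s hτ hσ rfl _ rfl).trans_lt ?_
        rcases hk with hk | ⟨rfl, hlt⟩
        · exact mul_nat_add_lt_mul_nat_add _ (hc _ hτ _ hσ) (by lia)
        · exact (add_lt_add_iff_left _).2 (natSum_strictMono_left _ hlt)
      · obtain ⟨k, τ, hτ, rfl, hk⟩ := exists_eq_mul_nat_add_of_lt hσ hb'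
        refine (ihb _ hb' r k hρ hτ rfl rfl).trans_lt ?_
        rcases hk with hk | ⟨rfl, hlt⟩
        · exact mul_nat_add_lt_mul_nat_add _ (hc _ hρ _ hτ) (by lia)
        · exact (add_lt_add_iff_left _).2 (natSum_strictMono_right _ hlt)

theorem natSum_lt_mul_nat {c : Ordinal.{u}} (hc : ∀ x < c, ∀ y < c, natSum x y < c) {r s : ℕ}
    {a b : Ordinal.{u}} (ha : a < c * ((r + 1 : ℕ) : Ordinal))
    (hb : b < c * ((s + 1 : ℕ) : Ordinal)) : natSum a b < c * ((r + s + 1 : ℕ) : Ordinal) := by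
  have key (t : ℕ) {x : Ordinal.{u}} (hx : x < c * ((t + 1 : ℕ) : Ordinal)) :
      ∃ (k : ℕ) (τ : Ordinal.{u}), τ < c ∧ x = c * k + τ ∧ k ≤ t := by
    obtain ⟨q, hq, τ, hτ, rfl⟩ := Ordinal.lt_mul_iff.1 hx
    obtain ⟨k, rfl⟩ := Ordinal.lt_omega0.1 (hq.trans (Ordinal.natCast_lt_omega0 _))
    exact ⟨k, τ, hτ, rfl, Nat.lt_succ_iff.1 (by exact_mod_cast hq)⟩
  obtain ⟨k, τ, hτ, rfl, hk⟩ := key r ha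
  obtain ⟨l, υ, hυ, rfl, hl⟩ := key s hb
  refine (natSum_mul_nat_add_le hc k l hτ hυ).trans_lt ?_
  simpa using mul_nat_add_lt_mul_nat_add 0 (hc _ hτ _ hυ) (show k + l < r + s + 1 by lia)

theorem natSum_lt_omega0_opow {α x y : Ordinal.{u}} (hx : x < Ordinal.omega0 ^ α)
    (hy : y < Ordinal.omega0 ^ α) : natSum x y < Ordinal.omega0 ^ α := by
  induction α using WellFoundedLT.induction generalizing x y with
  | ind α ih =>
    rcases eq_or_ne α 0 with rfl | hα
    · rw [Ordinal.opow_zero, Order.lt_one_iff] at *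
      subst hx hy
      exact nonpos_iff_eq_zero.1 (natSum_le_iff.2 (by simp))
    · obtain ⟨β, hβ, m, hm⟩ := (Ordinal.lt_omega0_opow hα).1 hx
      obtain ⟨γ, hγ, n, hn⟩ := (Ordinal.lt_omega0_opow hα).1 hy
      set δ := max β γ
      have hδ : δ < α := max_lt hβ hγ
      have key {ε z : Ordinal.{u}} {k : ℕ} (hε : ε ≤ δ) (hz : z < Ordinal.omega0 ^ ε * k) :
          z < Ordinal.omega0 ^ δ * ((k + 1 : ℕ) : Ordinal) := by
        refine hz.trans_le ?_
        gcongr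
        · exact Ordinal.omega0_pos
        · exact Nat.le_succ k
      exact (Ordinal.lt_omega0_opow hα).2 ⟨δ, hδ, _, natSum_lt_mul_nat (fun _ h _ h' => ih δ hδ h h')
        (key (le_max_left _ _) hm) (key (le_max_right _ _) hn)⟩

theorem exists_mul_nat_le_of_le_natSum {α a b : Ordinal.{u}} {n : ℕ}
    (h : Ordinal.omega0 ^ α * n ≤ natSum a b) :
    ∃ r s : ℕ, r + s = n ∧ Ordinal.omega0 ^ α * r ≤ a ∧ Ordinal.omega0 ^ α * s ≤ b := by
  classical
  set c := Ordinal.omega0 ^ α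
  by_cases han : c * n ≤ a
  · exact ⟨n, 0, by simp, han, by simp⟩
  -- `r` is the largest natural number with `c * r ≤ a`.
  have hex : ∃ r : ℕ, a < c * ((r + 1 : ℕ) : Ordinal) :=
    ⟨n, (not_le.1 han).trans_le (by gcongr; exact Nat.le_succ n)⟩
  obtain ⟨r, hr, hmin⟩ : ∃ r : ℕ, a < c * ((r + 1 : ℕ) : Ordinal) ∧ c * r ≤ a := by
    refine ⟨Nat.find hex, Nat.find_spec hex, ?_⟩
    rcases hk : Nat.find hex with _ | k
    · simp
    · exact not_lt.1 (Nat.find_min hex (m := k) (by lia))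
  have hrn : r < n := by
    by_contra! hle
    exact han (le_trans (by gcongr) hmin)
  obtain ⟨s, rfl⟩ := Nat.exists_eq_add_of_le hrn.le
  refine ⟨r, s, rfl, hmin, ?_⟩
  by_contra! hb
  obtain ⟨t, rfl⟩ : ∃ t, s = t + 1 := ⟨s - 1, by lia⟩
  exact h.not_gt (natSum_lt_mul_nat (fun _ h _ h' => natSum_lt_omega0_opow h h') hr hb)

end NaturalSum

section CantorBendixson

universe u v w

variable {X : Type u} {Y : Type v} [TopologicalSpace X] [TopologicalSpace Y]

theorem cbDeriv_zero (s : Set X) : cbDeriv s (0 : Ordinal.{w}) = s :=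
  Ordinal.limitRecOn_zero _ _ _

theorem cbDeriv_add_one (s : Set X) (o : Ordinal.{w}) :
    cbDeriv s (o + 1) = cbDeriv s o ∩ derivedSet (cbDeriv s o) :=
  Ordinal.limitRecOn_add_one _ _ _ _

theorem mem_cbDeriv_of_isSuccLimit {s : Set X} {o : Ordinal.{w}} (ho : Order.IsSuccLimit o)
    {x : X} : x ∈ cbDeriv s o ↔ ∀ b < o, x ∈ cbDeriv s b := by
  rw [cbDeriv, Ordinal.limitRecOn_limit _ _ _ _ ho]
  simp [cbDeriv]

theorem cbDeriv_antitone (s : Set X) : Antitone (cbDeriv.{u, w} s) := by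
  intro a b hab
  induction b using Ordinal.limitRecOn with
  | zero => rw [nonpos_iff_eq_zero.1 hab]
  | add_one b ih =>
    rcases hab.lt_or_eq with h | rfl
    · rw [cbDeriv_add_one]
      exact inter_subset_left.trans (ih (Order.lt_add_one_iff.1 h))
    · exact le_rfl
  | limit b hb ih =>
    rcases hab.lt_or_eq with h | rfl
    · exact fun x hx => (mem_cbDeriv_of_isSuccLimit hb).1 hx a h
    · exact le_rfl

theorem exists_mem_ne_of_mem_cbDeriv {s : Set X} {a b : Ordinal.{w}} (hab : a < b) {x : X}
    (hx : x ∈ cbDeriv s b) {U : Set X} (hU : U ∈ 𝓝 x) : ∃ y ∈ U, y ∈ cbDeriv s a ∧ y ≠ x := by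
  have h := cbDeriv_antitone s (Order.add_one_le_of_lt hab) hx
  rw [cbDeriv_add_one] at h
  obtain ⟨y, hy, hne⟩ := accPt_iff_nhds.1 h.2 U hU
  exact ⟨y, hy.1, hy.2, hne⟩

theorem exists_mem_cbDeriv_notMem_add_one {s : Set X} {x : X} (hx : x ∈ s) {a : Ordinal.{w}}
    (ha : x ∉ cbDeriv s a) : ∃ b < a, x ∈ cbDeriv s b ∧ x ∉ cbDeriv s (b + 1) := by
  induction a using Ordinal.limitRecOn with
  | zero => exact absurd (by rwa [cbDeriv_zero]) ha
  | add_one a ih =>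
    by_cases h : x ∈ cbDeriv s a
    · exact ⟨a, Order.lt_add_one_iff.2 le_rfl, h, ha⟩
    · obtain ⟨b, hb, hb'⟩ := ih h
      exact ⟨b, hb.trans (Order.lt_add_one_iff.2 le_rfl), hb'⟩
  | limit a hlim ih =>
    rw [mem_cbDeriv_of_isSuccLimit hlim] at ha
    push Not at ha
    obtain ⟨b, hb, hxb⟩ := ha
    obtain ⟨d, hd, hd'⟩ := ih b hb hxb
    exact ⟨d, hd.trans hb, hd'⟩

theorem mk_mem_cbDeriv_prod {s : Set X} {t : Set Y} {a b c : Ordinal.{w}} (hc : c ≤ natSum a b)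
    {x : X} {y : Y} (hx : x ∈ cbDeriv s a) (hy : y ∈ cbDeriv t b) :
    (x, y) ∈ cbDeriv (s ×ˢ t) c := by
  induction c using Ordinal.limitRecOn generalizing a b x y with
  | zero =>
    rw [cbDeriv_zero]
    refine ⟨?_, ?_⟩
    · simpa only [cbDeriv_zero] using cbDeriv_antitone s (zero_le (a := a)) hx
    · simpa only [cbDeriv_zero] using cbDeriv_antitone t (zero_le (a := b)) hy
  | add_one c ih =>
    have hlt : c < natSum a b := Order.add_one_le_iff.1 hc
    rw [cbDeriv_add_one]
    refine ⟨ih hlt.le hx hy, accPt_iff_nhds.2 fun W hW => ?_⟩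
    obtain ⟨U, hU, V, hV, hUV⟩ := mem_nhds_prod_iff.1 hW
    rcases lt_natSum_iff.1 hlt with ⟨a', ha', hle⟩ | ⟨b', hb', hle⟩
    · obtain ⟨z, hzU, hz, hne⟩ := exists_mem_ne_of_mem_cbDeriv ha' hx hU
      exact ⟨(z, y), ⟨hUV ⟨hzU, mem_of_mem_nhds hV⟩, ih hle hz hy⟩, by simpa using hne⟩
    · obtain ⟨z, hzV, hz, hne⟩ := exists_mem_ne_of_mem_cbDeriv hb' hy hV
      exact ⟨(x, z), ⟨hUV ⟨mem_of_mem_nhds hU, hzV⟩, ih hle hx hz⟩, by simpa using hne⟩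
  | limit c hlim ih =>
    exact (mem_cbDeriv_of_isSuccLimit hlim).2 fun d hd => ih d hd (hd.le.trans hc) hx hy

theorem exists_nhds_subsingleton_of_notMem_cbDeriv_add_one {s : Set X} {a : Ordinal.{w}} {x : X}
    (hx : x ∈ cbDeriv s a) (hx' : x ∉ cbDeriv s (a + 1)) :
    ∃ U ∈ 𝓝 x, ∀ z ∈ U, z ∈ cbDeriv s a → z = x := by
  rw [cbDeriv_add_one, mem_inter_iff, not_and, mem_derivedSet, accPt_iff_nhds] at hx'
  have h := hx' hx
  push Not at h
  obtain ⟨U, hU, h⟩ := h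
  exact ⟨U, hU, fun z hz hza => h z ⟨hz, hza⟩⟩

theorem mk_notMem_cbDeriv_prod {s : Set X} {t : Set Y} {a b : Ordinal.{w}} {x : X} {y : Y}
    (hx : x ∈ cbDeriv s a) (hx' : x ∉ cbDeriv s (a + 1))
    (hy : y ∈ cbDeriv t b) (hy' : y ∉ cbDeriv t (b + 1)) :
    (x, y) ∉ cbDeriv (s ×ˢ t) (natSum a b + 1) := by
  induction hc : natSum a b using WellFoundedLT.induction generalizing a b x y with
  | ind c ih =>
    subst hc
    obtain ⟨U, hU, hUx⟩ := exists_nhds_subsingleton_of_notMem_cbDeriv_add_one hx hx'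
    obtain ⟨V, hV, hVy⟩ := exists_nhds_subsingleton_of_notMem_cbDeriv_add_one hy hy'
    intro h
    rw [cbDeriv_add_one] at h
    obtain ⟨⟨z, z'⟩, ⟨⟨hzU, hzV⟩, hmem⟩, hne⟩ := accPt_iff_nhds.1 h.2 _ (prod_mem_nhds hU hV)
    have hst : (z, z') ∈ s ×ˢ t := by
      simpa only [cbDeriv_zero] using cbDeriv_antitone (s ×ˢ t) (zero_le (a := natSum a b)) hmem
    -- A point near an isolated point of a derivative has smaller rank, unless it is that point.
    have key {d e : Ordinal.{w}} (hd : z ∈ cbDeriv s d) (hd' : z ∉ cbDeriv s (d + 1))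
        (he : z' ∈ cbDeriv t e) (he' : z' ∉ cbDeriv t (e + 1)) : ¬ natSum d e < natSum a b :=
      fun hlt => ih _ hlt hd hd' he he' rfl
        (cbDeriv_antitone (s ×ˢ t) (Order.add_one_le_of_lt hlt) hmem)
    by_cases hz : z ∈ cbDeriv s a
    · obtain rfl := hUx z hzU hz
      by_cases hz' : z' ∈ cbDeriv t b
      · exact hne (by rw [hVy z' hzV hz'])
      · obtain ⟨e, he, h1, h2⟩ := exists_mem_cbDeriv_notMem_add_one hst.2 hz'
        exact key hz hx' h1 h2 (natSum_strictMono_right a he)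
    · obtain ⟨d, hd, h1, h2⟩ := exists_mem_cbDeriv_notMem_add_one hst.1 hz
      have hda := natSum_strictMono_left b hd
      by_cases hz' : z' ∈ cbDeriv t b
      · obtain rfl := hVy z' hzV hz'
        exact key h1 h2 hz' hy' hda
      · obtain ⟨e, he, h3, h4⟩ := exists_mem_cbDeriv_notMem_add_one hst.2 hz'
        exact key h1 h2 h3 h4 ((natSum_strictMono_right d he).trans hda)

theorem mem_cbDeriv_prod_iff {s : Set X} {t : Set Y} {c : Ordinal.{w}} {x : X} {y : Y} :
    (x, y) ∈ cbDeriv (s ×ˢ t) c ↔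
      ∃ a b, c ≤ natSum a b ∧ x ∈ cbDeriv s a ∧ y ∈ cbDeriv t b := by
  refine ⟨fun h => ?_, fun ⟨a, b, hc, hx, hy⟩ => mk_mem_cbDeriv_prod hc hx hy⟩
  have hst : (x, y) ∈ s ×ˢ t := by
    simpa only [cbDeriv_zero] using cbDeriv_antitone (s ×ˢ t) (zero_le (a := c)) h
  by_cases hx : x ∈ cbDeriv s c
  · exact ⟨c, 0, by simpa using add_le_natSum c 0, hx, by rw [cbDeriv_zero]; exact hst.2⟩
  by_cases hy : y ∈ cbDeriv t c
  · exact ⟨0, c, by simpa using add_le_natSum 0 c, by rw [cbDeriv_zero]; exact hst.1, hy⟩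
  obtain ⟨a, -, ha, ha'⟩ := exists_mem_cbDeriv_notMem_add_one hst.1 hx
  obtain ⟨b, -, hb, hb'⟩ := exists_mem_cbDeriv_notMem_add_one hst.2 hy
  refine ⟨a, b, ?_, ha, hb⟩
  by_contra! hlt
  exact mk_notMem_cbDeriv_prod ha ha' hb hb'
    (cbDeriv_antitone (s ×ˢ t) (Order.add_one_le_of_lt hlt) h)

end CantorBendixson


/-- Lemma 4.19 of the paper: the `ω^α · n`-th Cantor–Bendixson
derivative of a product space. -/
theorem cbDeriv_prod_omega0_pow_mul_nat {X Y : Type*} [TopologicalSpace X]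
    [TopologicalSpace Y] (α : Ordinal) (n : ℕ) :
    cbDeriv (Set.univ : Set (X × Y)) (Ordinal.omega0 ^ α * (n : Ordinal)) =
      ⋃ (r : ℕ) (s : ℕ) (_ : r + s = n),
        (cbDeriv (Set.univ : Set X) (Ordinal.omega0 ^ α * (r : Ordinal))) ×ˢ
          (cbDeriv (Set.univ : Set Y) (Ordinal.omega0 ^ α * (s : Ordinal))) := by
  ext ⟨x, y⟩
  rw [← univ_prod_univ, mem_cbDeriv_prod_iff]
  simp only [mem_iUnion, mem_prod, exists_prop]
  constructor
  · rintro ⟨a, b, hab, hx, hy⟩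
    obtain ⟨r, s, hrs, hr, hs⟩ := exists_mul_nat_le_of_le_natSum hab
    exact ⟨r, s, hrs, cbDeriv_antitone _ hr hx, cbDeriv_antitone _ hs hy⟩
  · rintro ⟨r, s, rfl, hx, hy⟩
    refine ⟨_, _, ?_, hx, hy⟩
    rw [Nat.cast_add, mul_add]
    exact add_le_natSum _ _
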